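/- arXiv:2305.05117 — 7 statements merged into one kernel-verified Lean document; each statement's English description precedes it below -/
import Mathlib

section
/- Let m ≥ 1, h > 0, and let A be a symmetric real m×m matrix. Let Δt, C₁, β₀, β₁ ∈ ℝ, η₁ ∈ ℝ^m, and suppose P⁰, Q⁰, P¹, Q¹, U¹ ∈ ℝ^m satisfy P¹ = P⁰ − Δt( A((Q¹+Q⁰)/2) + (1/2)·U¹ ⊙ (Q¹+Q⁰) ) + C₁ β₁ η₁ + (1/2)·Δt C₁ β₀ ( A η₁ + U¹ ⊙ η₁ ) and Q¹ = Q⁰ + Δt( A((P¹+P⁰)/2) + (1/2)·U¹ ⊙ (P¹+P⁰) ) − C₁ β₀ η₁ + (1/2)·Δt C₁ β₁ ( A η₁ + U¹ ⊙ η₁ ). Then ‖P¹‖_h² + ‖Q¹‖_h² = ‖P⁰ + C₁ β₁ η₁‖_h² + ‖Q⁰ − C₁ β₀ η₁‖_h²; that is, one step of the modified finite-difference scheme exactly transports the discrete charge of the noise-kicked data. -/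
open MeasureTheory ProbabilityTheory

/-- Weighted discrete inner product `⟨f, g⟩_h = h ∑ i f i * g i`. -/
noncomputable def iph {m : ℕ} (h : ℝ) (f g : Fin m → ℝ) : ℝ := h * ∑ i, f i * g i

/-- Squared discrete norm `‖f‖_h² = h ∑ i (f i)²`. -/
noncomputable def nsq {m : ℕ} (h : ℝ) (f : Fin m → ℝ) : ℝ := h * ∑ i, f i * f i

open Matrix in
/-- The implicit midpoint step of the Hamiltonian system generated by a symmetric matrix
preserves the discrete charge. -/
lemma nsq_add_nsq_eq_of_midpoint {m : ℕ} (h c : ℝ) {B : Matrix (Fin m) (Fin m) ℝ}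
    (hB : B.IsSymm) {p q a b : Fin m → ℝ}
    (hp : p - a = -(c • B *ᵥ (q + b))) (hq : q - b = c • B *ᵥ (p + a)) :
    nsq h p + nsq h q = nsq h a + nsq h b := by
  have nsq_sub (f g : Fin m → ℝ) : nsq h f - nsq h g = h * ((f - g) ⬝ᵥ (f + g)) := by
    simp only [nsq, dotProduct, ← mul_sub, ← Finset.sum_sub_distrib, Pi.sub_apply, Pi.add_apply]
    congr 1
    exact Finset.sum_congr rfl fun i _ => by ring
  have hsymm : B *ᵥ (q + b) ⬝ᵥ (p + a) = B *ᵥ (p + a) ⬝ᵥ (q + b) := by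
    rw [dotProduct_comm, dotProduct_mulVec, ← mulVec_transpose, hB.eq]
  have hsub := nsq_sub p a
  have hsub' := nsq_sub q b
  rw [hp, neg_dotProduct, smul_dotProduct, hsymm] at hsub
  rw [hq, smul_dotProduct] at hsub'
  linarith

/-- One step of the modified finite-difference scheme exactly transports the
discrete charge of the noise-kicked data. -/
theorem stmt_0 {m : ℕ} (hm : 1 ≤ m) (h : ℝ) (hh : 0 < h)
    (A : Matrix (Fin m) (Fin m) ℝ) (hA : A.IsSymm)
    (Δt C1 β0 β1 : ℝ) (η1 P0 Q0 P1 Q1 U1 : Fin m → ℝ)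
    (hP : P1 = P0
        - Δt • (A.mulVec ((2 : ℝ)⁻¹ • (Q1 + Q0)) + (2 : ℝ)⁻¹ • (U1 * (Q1 + Q0)))
        + (C1 * β1) • η1
        + ((2 : ℝ)⁻¹ * Δt * C1 * β0) • (A.mulVec η1 + U1 * η1))
    (hQ : Q1 = Q0
        + Δt • (A.mulVec ((2 : ℝ)⁻¹ • (P1 + P0)) + (2 : ℝ)⁻¹ • (U1 * (P1 + P0)))
        - (C1 * β0) • η1
        + ((2 : ℝ)⁻¹ * Δt * C1 * β1) • (A.mulVec η1 + U1 * η1)) :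
    nsq h P1 + nsq h Q1
      = nsq h (P0 + (C1 * β1) • η1) + nsq h (Q0 - (C1 * β0) • η1) := by
  have hdiag (v : Fin m → ℝ) : (A + Matrix.diagonal U1).mulVec v = A.mulVec v + U1 * v := by
    rw [Matrix.add_mulVec]
    congr 1
    ext i
    simp [Matrix.mulVec_diagonal]
  refine nsq_add_nsq_eq_of_midpoint h (Δt / 2) (B := A + Matrix.diagonal U1)
    (hA.add (Matrix.isSymm_diagonal U1)) ?_ ?_
  · ext i
    have hi := congrFun hP i
    simp only [hdiag, Matrix.mulVec_add, Matrix.mulVec_sub, Matrix.mulVec_smul, Pi.add_apply,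
      Pi.sub_apply, Pi.neg_apply, Pi.smul_apply, Pi.mul_apply, smul_eq_mul] at hi ⊢
    linear_combination hi
  · ext i
    have hi := congrFun hQ i
    simp only [hdiag, Matrix.mulVec_add, Matrix.mulVec_smul, Pi.add_apply,
      Pi.sub_apply, Pi.smul_apply, Pi.mul_apply, smul_eq_mul] at hi ⊢
    linear_combination hi
end

section
/- Let (Ω, ℱ, ℙ) be a probability space, m ≥ 1, h > 0, Δt > 0, C₁ ∈ ℝ, η₁ ∈ ℝ^m. Let P⁰, Q⁰ : Ω → ℝ^m be random vectors with E‖P⁰‖_h² < ∞ and E‖Q⁰‖_h² < ∞, and let β₀, β₁ be N(0, Δt)-distributed real random variables such that the pair (β₀, β₁) is independent of the pair (P⁰, Q⁰). Then E[‖P⁰ + C₁ β₁ η₁‖_h² + ‖Q⁰ − C₁ β₀ η₁‖_h²] = E[‖P⁰‖_h² + ‖Q⁰‖_h²] + 2 C₁² ‖η₁‖_h² Δt. -/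
open MeasureTheory ProbabilityTheory

lemma nsq_add_smul {m : ℕ} (h a : ℝ) (x y : Fin m → ℝ) :
    nsq h (x + a • y) = nsq h x + a * (2 * iph h x y) + a ^ 2 * nsq h y := by
  simp only [nsq, iph, Finset.mul_sum, ← Finset.sum_add_distrib]
  refine Finset.sum_congr rfl fun i _ => ?_
  simp only [Pi.add_apply, Pi.smul_apply, smul_eq_mul]
  ring

lemma measurable_iph_right {m : ℕ} (h : ℝ) (y : Fin m → ℝ) :
    Measurable fun x : Fin m → ℝ => iph h x y := by
  unfold iph
  fun_prop

lemma integrable_apply_of_integrable_nsq {Ω : Type*} [MeasurableSpace Ω] {μ : Measure Ω}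
    [IsFiniteMeasure μ] {m : ℕ} {h : ℝ} (hh : 0 < h) {X : Ω → Fin m → ℝ} (hX : Measurable X)
    (hXi : Integrable (fun ω => nsq h (X ω)) μ) (i : Fin m) :
    Integrable (fun ω => X ω i) μ := by
  have hXim : Measurable fun ω => X ω i := by fun_prop
  refine MemLp.integrable one_le_two ((memLp_two_iff_integrable_sq hXim.aestronglyMeasurable).2 ?_)
  refine (hXi.const_mul h⁻¹).mono' (hXim.pow_const 2).aestronglyMeasurable (.of_forall fun ω => ?_)
  rw [nsq, inv_mul_cancel_left₀ hh.ne', Real.norm_of_nonneg (sq_nonneg _), sq]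
  exact Finset.single_le_sum (f := fun j => X ω j * X ω j) (fun j _ => mul_self_nonneg _)
    (Finset.mem_univ i)

lemma integrable_iph_of_integrable_nsq {Ω : Type*} [MeasurableSpace Ω] {μ : Measure Ω}
    [IsFiniteMeasure μ] {m : ℕ} {h : ℝ} (hh : 0 < h) {X : Ω → Fin m → ℝ} (hX : Measurable X)
    (hXi : Integrable (fun ω => nsq h (X ω)) μ) (y : Fin m → ℝ) :
    Integrable (fun ω => iph h (X ω) y) μ :=
  (integrable_finsetSum _ fun i _ =>
    (integrable_apply_of_integrable_nsq hh hX hXi i).mul_const (y i)).const_mul h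

/-- Kicking a square-integrable random vector by an independent centred Gaussian multiple of a
fixed vector raises the expected squared norm by the variance times the squared norm of that
vector. -/
lemma integrable_and_integral_nsq_add_gaussian_smul {Ω : Type*} [MeasurableSpace Ω]
    {μ : Measure Ω} [IsProbabilityMeasure μ] {m : ℕ} {h : ℝ} (hh : 0 < h) {v : NNReal}
    {X : Ω → Fin m → ℝ} (hX : Measurable X) (hXi : Integrable (fun ω => nsq h (X ω)) μ)
    {β : Ω → ℝ} (hβ : HasLaw β (gaussianReal 0 v) μ) (hind : IndepFun β X μ)
    (c : ℝ) (y : Fin m → ℝ) :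
    Integrable (fun ω => nsq h (X ω + (c * β ω) • y)) μ ∧
      ∫ ω, nsq h (X ω + (c * β ω) • y) ∂μ = ∫ ω, nsq h (X ω) ∂μ + c ^ 2 * nsq h y * v := by
  have hexp (ω : Ω) : nsq h (X ω + (c * β ω) • y) =
      nsq h (X ω) + 2 * c * (β ω * iph h (X ω) y) + c ^ 2 * nsq h y * β ω ^ 2 := by
    rw [nsq_add_smul]
    ring
  have hmean : ∫ ω, β ω ∂μ = 0 := by rw [hβ.integral_eq, integral_id_gaussianReal]
  have hLp : MemLp β 2 μ := by
    have := memLp_id_gaussianReal' (μ := 0) (v := v) 2 (by simp)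
    rw [← hβ.map_eq] at this
    exact (memLp_map_measure_iff (by fun_prop) hβ.aemeasurable).1 this
  have hsq : ∫ ω, β ω ^ 2 ∂μ = v := by
    rw [← variance_of_integral_eq_zero hβ.aemeasurable hmean, hβ.variance_eq,
      variance_id_gaussianReal]
  have hind' : IndepFun β (fun ω => iph h (X ω) y) μ :=
    hind.comp measurable_id (measurable_iph_right h y)
  have hI := integrable_iph_of_integrable_nsq hh hX hXi y
  have hcross : Integrable (fun ω => 2 * c * (β ω * iph h (X ω) y)) μ :=
    (hind'.integrable_mul (hLp.integrable one_le_two) hI).const_mul _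
  have hquad : Integrable (fun ω => c ^ 2 * nsq h y * β ω ^ 2) μ :=
    hLp.integrable_sq.const_mul _
  simp only [hexp]
  refine ⟨(hXi.add hcross).add hquad, ?_⟩
  rw [integral_add (by exact hXi.add hcross) hquad, integral_add hXi hcross, integral_const_mul,
    integral_const_mul, hsq,
    hind'.integral_fun_mul_eq_mul_integral hLp.aestronglyMeasurable hI.aestronglyMeasurable, hmean]
  ring

/-- The expected discrete charge of the noise-kicked data grows by exactly
`2 C₁² ‖η₁‖_h² Δt`. -/
theorem stmt_1 {Ω : Type*} [MeasureSpace Ω] [IsProbabilityMeasure (ℙ : Measure Ω)]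
    {m : ℕ} (hm : 1 ≤ m) (h : ℝ) (hh : 0 < h) (Δt : ℝ) (hΔt : 0 < Δt)
    (C1 : ℝ) (η1 : Fin m → ℝ)
    (P0 Q0 : Ω → Fin m → ℝ) (hP0m : Measurable P0) (hQ0m : Measurable Q0)
    (hP0i : Integrable (fun ω => nsq h (P0 ω)) ℙ)
    (hQ0i : Integrable (fun ω => nsq h (Q0 ω)) ℙ)
    (β0 β1 : Ω → ℝ) (hβ0m : Measurable β0) (hβ1m : Measurable β1)
    (hβ0 : Measure.map β0 ℙ = gaussianReal 0 Δt.toNNReal)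
    (hβ1 : Measure.map β1 ℙ = gaussianReal 0 Δt.toNNReal)
    (hind : IndepFun (fun ω => (β0 ω, β1 ω)) (fun ω => (P0 ω, Q0 ω)) ℙ) :
    ∫ ω, (nsq h (P0 ω + (C1 * β1 ω) • η1) + nsq h (Q0 ω - (C1 * β0 ω) • η1)) ∂ℙ
      = (∫ ω, (nsq h (P0 ω) + nsq h (Q0 ω)) ∂ℙ) + 2 * C1 ^ 2 * nsq h η1 * Δt := by
  obtain ⟨hPi, hP⟩ := integrable_and_integral_nsq_add_gaussian_smul hh hP0m hP0i
    ⟨hβ1m.aemeasurable, hβ1⟩ (hind.comp measurable_snd measurable_fst) C1 η1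
  obtain ⟨hQi, hQ⟩ := integrable_and_integral_nsq_add_gaussian_smul hh hQ0m hQ0i
    ⟨hβ0m.aemeasurable, hβ0⟩ (hind.comp measurable_fst measurable_snd) (-C1) η1
  simp only [neg_mul, neg_smul, ← sub_eq_add_neg] at hQi hQ
  rw [integral_add hPi hQi, integral_add hP0i hQ0i, hP, hQ, Real.coe_toNNReal _ hΔt.le]
  ring
end

section
/- Let (Ω, ℱ, ℙ) be a probability space, M ≥ 2, h > 0, Δt > 0, C₁ ∈ ℝ, η₁ ∈ ℝ^{M−1}, and let A be the central-difference matrix. Let Pⁿ, Qⁿ : Ω → ℝ^{M−1} (0 ≤ n ≤ N) and Uⁿ : Ω → ℝ^{M−1} (1 ≤ n ≤ N) be random vectors with E‖Pⁿ‖_h² < ∞ and E‖Qⁿ‖_h² < ∞ for all n, and for each 1 ≤ n ≤ N let β₀ⁿ, β₁ⁿ be N(0, Δt)-distributed real random variables such that the pair (β₀ⁿ, β₁ⁿ) is independent of the pair (Pⁿ⁻¹, Qⁿ⁻¹). Suppose that almost surely, for each 1 ≤ n ≤ N, Pⁿ = Pⁿ⁻¹ − Δt( A((Qⁿ+Qⁿ⁻¹)/2)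 + (1/2)·Uⁿ ⊙ (Qⁿ+Qⁿ⁻¹) ) + C₁ β₁ⁿ η₁ + (1/2)·Δt C₁ β₀ⁿ ( A η₁ + Uⁿ ⊙ η₁ ) and Qⁿ = Qⁿ⁻¹ + Δt( A((Pⁿ+Pⁿ⁻¹)/2) + (1/2)·Uⁿ ⊙ (Pⁿ+Pⁿ⁻¹) ) − C₁ β₀ⁿ η₁ + (1/2)·Δt C₁ β₁ⁿ ( A η₁ + Uⁿ ⊙ η₁ ). Then for every 0 ≤ n ≤ N, E[𝒩(Pⁿ, Qⁿ)] = E[𝒩(P⁰, Q⁰)] + 2 C₁² ‖η₁‖_h² · n Δt. -/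
open MeasureTheory ProbabilityTheory

/-- The `(M-1) × (M-1)` central-difference matrix: `-2/h²` on the diagonal and
`1/h²` on the first super- and sub-diagonals. -/
noncomputable def cdMatrix (M : ℕ) (h : ℝ) : Matrix (Fin (M - 1)) (Fin (M - 1)) ℝ :=
  Matrix.of fun i j =>
    if (i : ℕ) = (j : ℕ) then -2 / h ^ 2
    else if (i : ℕ) + 1 = (j : ℕ) ∨ (j : ℕ) + 1 = (i : ℕ) then 1 / h ^ 2
    else 0

theorem iph_eq_dotProduct {m : ℕ} (h : ℝ) (f g : Fin m → ℝ) : iph h f g = h * (f ⬝ᵥ g) := rfl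

theorem nsq_eq_dotProduct {m : ℕ} (h : ℝ) (f : Fin m → ℝ) : nsq h f = h * (f ⬝ᵥ f) := rfl

theorem cdMatrix_isSymm (M : ℕ) (h : ℝ) : (cdMatrix M h).IsSymm := by
  ext i j
  simp only [cdMatrix, Matrix.transpose_apply, Matrix.of_apply, eq_comm (a := (j : ℕ)),
    or_comm (a := (j : ℕ) + 1 = (i : ℕ))]

/-- A step of the midpoint rule with a symmetric generator preserves the squared norm. -/
theorem dotProduct_add_dotProduct_eq_of_midpoint {ι : Type*} [Fintype ι] {S : Matrix ι ι ℝ}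
    (hS : S.IsSymm) {p q p' q' : ι → ℝ} (hp : p' - p = -S.mulVec (q' + q))
    (hq : q' - q = S.mulVec (p' + p)) :
    p' ⬝ᵥ p' + q' ⬝ᵥ q' = p ⬝ᵥ p + q ⬝ᵥ q := by
  have key : (p' - p) ⬝ᵥ (p' + p) + (q' - q) ⬝ᵥ (q' + q) = 0 := by
    rw [hp, hq, neg_dotProduct, dotProduct_comm (S.mulVec (p' + p)), Matrix.dotProduct_mulVec,
      ← Matrix.mulVec_transpose, hS.eq, neg_add_cancel]
  simp only [sub_dotProduct, dotProduct_add] at key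
  linarith [dotProduct_comm p p', dotProduct_comm q q']

/-- Pathwise charge identity for one step of the scheme. -/
theorem nsq_add_nsq_of_step {m : ℕ} (h Δt b0 b1 : ℝ) {A : Matrix (Fin m) (Fin m) ℝ}
    (hA : A.IsSymm) (η u p q p' q' : Fin m → ℝ)
    (hp : p' = p - Δt • (A.mulVec ((2 : ℝ)⁻¹ • (q' + q)) + (2 : ℝ)⁻¹ • (u * (q' + q)))
      + b1 • η + ((2 : ℝ)⁻¹ * Δt * b0) • (A.mulVec η + u * η))
    (hq : q' = q + Δt • (A.mulVec ((2 : ℝ)⁻¹ • (p' + p)) + (2 : ℝ)⁻¹ • (u * (p' + p)))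
      - b0 • η + ((2 : ℝ)⁻¹ * Δt * b1) • (A.mulVec η + u * η)) :
    nsq h p' + nsq h q' = nsq h p + nsq h q
      + (2 * (b1 * iph h p η) - 2 * (b0 * iph h q η) + (b1 ^ 2 + b0 ^ 2) * nsq h η) := by
  have hS : (((2 : ℝ)⁻¹ * Δt) • (A + Matrix.diagonal u)).IsSymm :=
    (hA.add (Matrix.isSymm_diagonal u)).smul _
  have hdiag (v : Fin m → ℝ) : (Matrix.diagonal u).mulVec v = u * v := by
    ext i; simp [Matrix.mulVec_diagonal]
  have key := dotProduct_add_dotProduct_eq_of_midpoint hS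
    (p := p + b1 • η) (q := q - b0 • η) (p' := p') (q' := q')
    (by
      ext i
      have := congrFun hp i
      simp only [Matrix.smul_mulVec, Matrix.add_mulVec, hdiag, Matrix.mulVec_add, Matrix.mulVec_sub,
        Matrix.mulVec_smul, Pi.add_apply, Pi.sub_apply, Pi.neg_apply, Pi.smul_apply, Pi.mul_apply,
        smul_eq_mul] at this ⊢
      linear_combination this)
    (by
      ext i
      have := congrFun hq i
      simp only [Matrix.smul_mulVec, Matrix.add_mulVec, hdiag, Matrix.mulVec_add,
        Matrix.mulVec_smul, Pi.add_apply, Pi.sub_apply, Pi.smul_apply, Pi.mul_apply,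
        smul_eq_mul] at this ⊢
      linear_combination this)
  simp only [add_dotProduct, dotProduct_add, sub_dotProduct, dotProduct_sub, smul_dotProduct,
    dotProduct_smul, smul_eq_mul, dotProduct_comm η] at key
  simp only [nsq_eq_dotProduct, iph_eq_dotProduct]
  linear_combination h * key

section Moments

variable {Ω : Type*} [MeasurableSpace Ω] {μ : Measure Ω}

theorem memLp_two_of_map_eq_gaussianReal {β : Ω → ℝ} (hβm : Measurable β) {c : ℝ} {v : NNReal}
    (hβ : μ.map β = gaussianReal c v) : MemLp β 2 μ := by
  have := memLp_id_gaussianReal (μ := c) (v := v) 2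
  rw [← hβ] at this
  exact this.comp_of_map hβm.aemeasurable

theorem integral_eq_of_map_eq_gaussianReal {β : Ω → ℝ} (hβm : Measurable β) {c : ℝ} {v : NNReal}
    (hβ : μ.map β = gaussianReal c v) : ∫ ω, β ω ∂μ = c := by
  rw [← integral_map (f := fun x => x) hβm.aemeasurable aestronglyMeasurable_id, hβ,
    integral_id_gaussianReal]

theorem integral_sq_of_map_eq_gaussianReal {β : Ω → ℝ} (hβm : Measurable β) {v : NNReal}
    (hβ : μ.map β = gaussianReal 0 v) : ∫ ω, β ω ^ 2 ∂μ = v := by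
  rw [← integral_map (f := fun x => x ^ 2) hβm.aemeasurable (by fun_prop), hβ]
  have := variance_of_integral_eq_zero (μ := gaussianReal 0 v) (X := fun x => x) (by fun_prop)
    integral_id_gaussianReal
  rw [← this, variance_fun_id_gaussianReal]

theorem measurable_iph_left {m : ℕ} (h : ℝ) (η : Fin m → ℝ) :
    Measurable fun p : Fin m → ℝ => iph h p η := by
  unfold iph; fun_prop

theorem abs_iph_le {m : ℕ} {h : ℝ} (hh : 0 ≤ h) (f g : Fin m → ℝ) :
    |iph h f g| ≤ nsq h f + nsq h g := by
  have h1 : 0 ≤ (f + g) ⬝ᵥ (f + g) := Finset.sum_nonneg fun i _ => mul_self_nonneg _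
  have h2 : 0 ≤ (f - g) ⬝ᵥ (f - g) := Finset.sum_nonneg fun i _ => mul_self_nonneg _
  have h3 : 0 ≤ f ⬝ᵥ f := Finset.sum_nonneg fun i _ => mul_self_nonneg _
  have h4 : 0 ≤ g ⬝ᵥ g := Finset.sum_nonneg fun i _ => mul_self_nonneg _
  simp only [add_dotProduct, dotProduct_add, sub_dotProduct, dotProduct_sub,
    dotProduct_comm g f] at h1 h2
  rw [iph_eq_dotProduct, nsq_eq_dotProduct, nsq_eq_dotProduct, abs_mul, abs_of_nonneg hh, ← mul_add]
  exact mul_le_mul_of_nonneg_left (abs_le.2 ⟨by linarith, by linarith⟩) hh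

theorem integrable_iph [IsFiniteMeasure μ] {m : ℕ} {h : ℝ} (hh : 0 ≤ h) {p : Ω → Fin m → ℝ}
    (hpm : Measurable p) (hpi : Integrable (fun ω => nsq h (p ω)) μ) (η : Fin m → ℝ) :
    Integrable (fun ω => iph h (p ω) η) μ :=
  (hpi.add (integrable_const (nsq h η))).mono'
    ((measurable_iph_left h η).comp hpm).aestronglyMeasurable
    (Filter.Eventually.of_forall fun ω => abs_iph_le hh (p ω) η)

/-- Expected increment of the charge when the state is shifted by independent Gaussian noise. -/
theorem integral_charge_increment [IsProbabilityMeasure μ] {m : ℕ} {h : ℝ} (hh : 0 ≤ h)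
    {v : NNReal} (c : ℝ) (η : Fin m → ℝ) {p q : Ω → Fin m → ℝ} (hpm : Measurable p)
    (hqm : Measurable q) (hpi : Integrable (fun ω => nsq h (p ω)) μ)
    (hqi : Integrable (fun ω => nsq h (q ω)) μ) {β0 β1 : Ω → ℝ} (hβ0m : Measurable β0)
    (hβ1m : Measurable β1) (hβ0 : μ.map β0 = gaussianReal 0 v)
    (hβ1 : μ.map β1 = gaussianReal 0 v) (hind0 : IndepFun β0 q μ) (hind1 : IndepFun β1 p μ) :
    ∫ ω, (nsq h (p ω) + nsq h (q ω) + (2 * (c * β1 ω * iph h (p ω) η)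
        - 2 * (c * β0 ω * iph h (q ω) η) + ((c * β1 ω) ^ 2 + (c * β0 ω) ^ 2) * nsq h η)) ∂μ
      = ∫ ω, (nsq h (p ω) + nsq h (q ω)) ∂μ + 2 * c ^ 2 * nsq h η * v := by
  have cross {β : Ω → ℝ} {x : Ω → Fin m → ℝ} (hβm : Measurable β)
      (hβ : μ.map β = gaussianReal 0 v) (hxm : Measurable x)
      (hxi : Integrable (fun ω => nsq h (x ω)) μ) (hind : IndepFun β x μ) :
      Integrable (fun ω => β ω * iph h (x ω) η) μ ∧ ∫ ω, β ω * iph h (x ω) η ∂μ = 0 := by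
    have hi : IndepFun β (fun ω => iph h (x ω) η) μ :=
      hind.comp measurable_id (measurable_iph_left h η)
    have hβi := (memLp_two_of_map_eq_gaussianReal hβm hβ).integrable one_le_two
    have hxi' := integrable_iph hh hxm hxi η
    refine ⟨hi.integrable_mul hβi hxi', ?_⟩
    rw [hi.integral_fun_mul_eq_mul_integral hβi.aestronglyMeasurable hxi'.aestronglyMeasurable,
      integral_eq_of_map_eq_gaussianReal hβm hβ, zero_mul]
  obtain ⟨i1, e1⟩ := cross hβ1m hβ1 hpm hpi hind1
  obtain ⟨i0, e0⟩ := cross hβ0m hβ0 hqm hqi hind0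
  have s1 := (memLp_two_of_map_eq_gaussianReal hβ1m hβ1).integrable_sq
  have s0 := (memLp_two_of_map_eq_gaussianReal hβ0m hβ0).integrable_sq
  have rearrange (ω : Ω) : nsq h (p ω) + nsq h (q ω) + (2 * (c * β1 ω * iph h (p ω) η)
        - 2 * (c * β0 ω * iph h (q ω) η) + ((c * β1 ω) ^ 2 + (c * β0 ω) ^ 2) * nsq h η)
      = (nsq h (p ω) + nsq h (q ω)) + (2 * c * (β1 ω * iph h (p ω) η)
        + (-2 * c * (β0 ω * iph h (q ω) η) + c ^ 2 * nsq h η * (β1 ω ^ 2 + β0 ω ^ 2))) := by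
    ring
  simp_rw [rearrange]
  have hpq : Integrable (fun ω => nsq h (p ω) + nsq h (q ω)) μ := hpi.add hqi
  have i1' := i1.const_mul (2 * c)
  have i0' := i0.const_mul (-2 * c)
  have s' : Integrable (fun ω => c ^ 2 * nsq h η * (β1 ω ^ 2 + β0 ω ^ 2)) μ :=
    (s1.add s0).const_mul _
  rw [integral_add hpq (by fun_prop), integral_add i1' (by fun_prop), integral_add i0' s',
    integral_const_mul, integral_const_mul, integral_const_mul, integral_add s1 s0, e1, e0,
    integral_sq_of_map_eq_gaussianReal hβ1m hβ1, integral_sq_of_map_eq_gaussianReal hβ0m hβ0]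
  ring

end Moments

/-- The modified finite-difference fully-discrete scheme (central difference in
space) preserves the averaged charge evolution law. -/
theorem stmt_2 {Ω : Type*} [MeasureSpace Ω] [IsProbabilityMeasure (ℙ : Measure Ω)]
    {M : ℕ} (hM : 2 ≤ M) (h : ℝ) (hh : 0 < h) (Δt : ℝ) (hΔt : 0 < Δt)
    (C1 : ℝ) (η1 : Fin (M - 1) → ℝ) (N : ℕ)
    (P Q U : ℕ → Ω → Fin (M - 1) → ℝ)
    (hPm : ∀ n ≤ N, Measurable (P n)) (hQm : ∀ n ≤ N, Measurable (Q n))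
    (hPi : ∀ n ≤ N, Integrable (fun ω => nsq h (P n ω)) ℙ)
    (hQi : ∀ n ≤ N, Integrable (fun ω => nsq h (Q n ω)) ℙ)
    (β0 β1 : ℕ → Ω → ℝ)
    (hβ0m : ∀ n, 1 ≤ n → n ≤ N → Measurable (β0 n))
    (hβ1m : ∀ n, 1 ≤ n → n ≤ N → Measurable (β1 n))
    (hβ0 : ∀ n, 1 ≤ n → n ≤ N → Measure.map (β0 n) ℙ = gaussianReal 0 Δt.toNNReal)
    (hβ1 : ∀ n, 1 ≤ n → n ≤ N → Measure.map (β1 n) ℙ = gaussianReal 0 Δt.toNNReal)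
    (hind : ∀ n, 1 ≤ n → n ≤ N →
      IndepFun (fun ω => (β0 n ω, β1 n ω)) (fun ω => (P (n - 1) ω, Q (n - 1) ω)) ℙ)
    (hscheme : ∀ᵐ ω ∂ℙ, ∀ n, 1 ≤ n → n ≤ N →
      P n ω = P (n - 1) ω
          - Δt • ((cdMatrix M h).mulVec ((2 : ℝ)⁻¹ • (Q n ω + Q (n - 1) ω))
              + (2 : ℝ)⁻¹ • (U n ω * (Q n ω + Q (n - 1) ω)))
          + (C1 * β1 n ω) • η1
          + ((2 : ℝ)⁻¹ * Δt * C1 * β0 n ω) • ((cdMatrix M h).mulVec η1 + U n ω * η1)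
      ∧ Q n ω = Q (n - 1) ω
          + Δt • ((cdMatrix M h).mulVec ((2 : ℝ)⁻¹ • (P n ω + P (n - 1) ω))
              + (2 : ℝ)⁻¹ • (U n ω * (P n ω + P (n - 1) ω)))
          - (C1 * β0 n ω) • η1
          + ((2 : ℝ)⁻¹ * Δt * C1 * β1 n ω) • ((cdMatrix M h).mulVec η1 + U n ω * η1)) :
    ∀ n ≤ N, ∫ ω, (nsq h (P n ω) + nsq h (Q n ω)) ∂ℙ
      = (∫ ω, (nsq h (P 0 ω) + nsq h (Q 0 ω)) ∂ℙ) + 2 * C1 ^ 2 * nsq h η1 * (n * Δt) := by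
  intro n
  induction n with
  | zero => intro _; simp
  | succ k ih =>
    intro hk
    have hk1 : 1 ≤ k + 1 := Nat.le_add_left 1 k
    have hk' : k ≤ N := Nat.le_of_succ_le hk
    have hi := hind (k + 1) hk1 hk
    rw [Nat.add_sub_cancel] at hi
    have step : ∀ᵐ ω ∂ℙ, nsq h (P (k + 1) ω) + nsq h (Q (k + 1) ω)
        = nsq h (P k ω) + nsq h (Q k ω) + (2 * (C1 * β1 (k + 1) ω * iph h (P k ω) η1)
          - 2 * (C1 * β0 (k + 1) ω * iph h (Q k ω) η1)
          + ((C1 * β1 (k + 1) ω) ^ 2 + (C1 * β0 (k + 1) ω) ^ 2) * nsq h η1) := by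
      filter_upwards [hscheme] with ω hω
      obtain ⟨hp, hq⟩ := hω (k + 1) hk1 hk
      rw [Nat.add_sub_cancel, mul_assoc _ C1] at hp hq
      exact nsq_add_nsq_of_step h Δt _ _ (cdMatrix_isSymm M h) η1 _ _ _ _ _ hp hq
    rw [integral_congr_ae step, integral_charge_increment hh.le C1 η1 (hPm k hk') (hQm k hk')
      (hPi k hk') (hQi k hk') (hβ0m _ hk1 hk) (hβ1m _ hk1 hk) (hβ0 _ hk1 hk) (hβ1 _ hk1 hk)
      (hi.comp measurable_fst measurable_snd) (hi.comp measurable_snd measurable_fst),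
      ih hk', Real.coe_toNNReal _ hΔt.le]
    push_cast
    ring
end

section
/- Let m ≥ 1, h > 0, Δt ∈ ℝ, and let A be a symmetric real m×m matrix. Suppose P̄, Q̄, Ū, V̄, P¹, Q¹, U¹, V¹ ∈ ℝ^m satisfy P¹ = P̄ − Δt( A((Q¹+Q̄)/2) + (1/2)·U¹ ⊙ (Q¹+Q̄) ), Q¹ = Q̄ + Δt( A((P¹+P̄)/2) + (1/2)·U¹ ⊙ (P¹+P̄) ), V¹ = V̄ + Δt( (1/4)·A(U¹+Ū) − (1/4)·(U¹+Ū) + (1/2)·(P̄ ⊙ P̄ + Q̄ ⊙ Q̄) ), and U¹ = Ū + Δt (V¹ + V̄). Then ℋ(P¹, Q¹, U¹, V¹) = ℋ(P̄, Q̄, Ū, V̄); that is, the deterministic one-step map of the scheme exactly conserves the discrete energy. -/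
open MeasureTheory ProbabilityTheory

/-- The discrete energy `ℋ(P,Q,U,V)` associated with a symmetric matrix `A`. -/
noncomputable def energy {m : ℕ} (h : ℝ) (A : Matrix (Fin m) (Fin m) ℝ)
    (P Q U V : Fin m → ℝ) : ℝ :=
  2 * iph h U (P * P + Q * Q) - nsq h U - 4 * nsq h V
    + iph h U (A.mulVec U) + 2 * iph h P (A.mulVec P) + 2 * iph h Q (A.mulVec Q)

lemma Matrix.IsSymm.sum_mul_mulVec_comm {m : ℕ} {A : Matrix (Fin m) (Fin m) ℝ} (hA : A.IsSymm)
    (x y : Fin m → ℝ) : ∑ i, x i * A.mulVec y i = ∑ i, y i * A.mulVec x i := by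
  change x ⬝ᵥ A.mulVec y = y ⬝ᵥ A.mulVec x
  rw [Matrix.dotProduct_mulVec, ← Matrix.mulVec_transpose, hA.eq, dotProduct_comm]

/-- The energy written as a single sum of local densities. -/
lemma energy_eq_mul_sum {m : ℕ} (h : ℝ) (A : Matrix (Fin m) (Fin m) ℝ)
    (P Q U V : Fin m → ℝ) :
    energy h A P Q U V = h * ∑ i, (2 * (U i * (P i * P i + Q i * Q i)) - U i * U i
      - 4 * (V i * V i) + U i * A.mulVec U i + 2 * (P i * A.mulVec P i)
      + 2 * (Q i * A.mulVec Q i)) := by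
  simp only [energy, iph, nsq, Pi.add_apply, Pi.mul_apply, Finset.sum_add_distrib,
    Finset.sum_sub_distrib, ← Finset.mul_sum]
  ring

/-- The deterministic one-step map of the scheme exactly conserves the discrete
energy. -/
theorem stmt_3 {m : ℕ} (hm : 1 ≤ m) (h : ℝ) (hh : 0 < h) (Δt : ℝ)
    (A : Matrix (Fin m) (Fin m) ℝ) (hA : A.IsSymm)
    (Pb Qb Ub Vb P1 Q1 U1 V1 : Fin m → ℝ)
    (hP : P1 = Pb
        - Δt • (A.mulVec ((2 : ℝ)⁻¹ • (Q1 + Qb)) + (2 : ℝ)⁻¹ • (U1 * (Q1 + Qb))))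
    (hQ : Q1 = Qb
        + Δt • (A.mulVec ((2 : ℝ)⁻¹ • (P1 + Pb)) + (2 : ℝ)⁻¹ • (U1 * (P1 + Pb))))
    (hV : V1 = Vb
        + Δt • ((4 : ℝ)⁻¹ • A.mulVec (U1 + Ub) - (4 : ℝ)⁻¹ • (U1 + Ub)
            + (2 : ℝ)⁻¹ • (Pb * Pb + Qb * Qb)))
    (hU : U1 = Ub + Δt • (V1 + Vb)) :
    energy h A P1 Q1 U1 V1 = energy h A Pb Qb Ub Vb := by
  have exchange_eq_zero : ∑ i, (2 * (P1 i * A.mulVec Pb i - Pb i * A.mulVec P1 i)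
      + 2 * (Q1 i * A.mulVec Qb i - Qb i * A.mulVec Q1 i)
      + (U1 i * A.mulVec Ub i - Ub i * A.mulVec U1 i)) = 0 := by
    simp only [Finset.sum_add_distrib, ← Finset.mul_sum, Finset.sum_sub_distrib,
      hA.sum_mul_mulVec_comm P1 Pb, hA.sum_mul_mulVec_comm Q1 Qb, hA.sum_mul_mulVec_comm U1 Ub]
    ring
  rw [energy_eq_mul_sum, energy_eq_mul_sum]
  congr 1
  rw [← sub_eq_zero, ← Finset.sum_sub_distrib, ← neg_eq_zero, ← exchange_eq_zero,
    ← Finset.sum_neg_distrib]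
  refine Finset.sum_congr rfl fun i _ => ?_
  have hPi := congrFun hP i
  have hQi := congrFun hQ i
  have hVi := congrFun hV i
  have hUi := congrFun hU i
  simp only [Pi.add_apply, Pi.sub_apply, Pi.mul_apply, Pi.smul_apply, smul_eq_mul,
    Matrix.mulVec_add, Matrix.mulVec_smul] at hPi hQi hVi hUi
  linear_combination
    -2 * (A.mulVec P1 i + A.mulVec Pb i + U1 i * (P1 i + Pb i)) * hPi
    - 2 * (A.mulVec Q1 i + A.mulVec Qb i + U1 i * (Q1 i + Qb i)) * hQi
    + 4 * (V1 i + Vb i) * hVi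
    - (A.mulVec U1 i + A.mulVec Ub i - (U1 i + Ub i) + 2 * (Pb i * Pb i + Qb i * Qb i)) * hUi
end

section
/- Let M ≥ 2, h > 0, let A be the central-difference matrix, and let P, Q, U, V : ℝ → ℝ^{M−1} be functions such that for every t ∈ ℝ, Q has derivative A P(t) + U(t) ⊙ P(t) at t, P has derivative −(A Q(t) + U(t) ⊙ Q(t)) at t, V has derivative (1/2)·(A U(t) − U(t) + P(t) ⊙ P(t) + Q(t) ⊙ Q(t)) at t, and U has derivative 2 V(t) at t. Then the discrete charge is conserved: for every t ∈ ℝ, ‖P(t)‖_h² + ‖Q(t)‖_h² = ‖P(0)‖_h² + ‖Q(0)‖_h². -/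
open MeasureTheory ProbabilityTheory

theorem Matrix.IsSymm.dotProduct_mulVec_comm {n R : Type*} [Fintype n] [CommSemiring R]
    {A : Matrix n n R} (hA : A.IsSymm) (x y : n → R) :
    x ⬝ᵥ A.mulVec y = y ⬝ᵥ A.mulVec x := by
  rw [Matrix.dotProduct_mulVec, ← Matrix.mulVec_transpose, hA.eq, dotProduct_comm]

theorem hasDerivAt_nsq {m : ℕ} (h : ℝ) {f : ℝ → Fin m → ℝ} {f' : Fin m → ℝ} {t : ℝ}
    (hf : HasDerivAt f f' t) :
    HasDerivAt (fun s => nsq h (f s)) (2 * h * (f t ⬝ᵥ f')) t := by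
  have hi := hasDerivAt_pi.1 hf
  have hs := (HasDerivAt.fun_sum (u := Finset.univ)
    fun i _ => (hi i).fun_mul (hi i)).const_mul h
  refine hs.congr_deriv ?_
  simp only [dotProduct, Finset.mul_sum]
  exact Finset.sum_congr rfl fun i _ => by ring

/-- The noise-free central-difference semi-discretization conserves the
discrete charge. -/
theorem stmt_11 {M : ℕ} (hM : 2 ≤ M) (h : ℝ) (hh : 0 < h)
    (P Q U V : ℝ → Fin (M - 1) → ℝ)
    (hQ' : ∀ t, HasDerivAt Q ((cdMatrix M h).mulVec (P t) + U t * P t) t)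
    (hP' : ∀ t, HasDerivAt P (-((cdMatrix M h).mulVec (Q t) + U t * Q t)) t)
    (hV' : ∀ t, HasDerivAt V
      ((2 : ℝ)⁻¹ • ((cdMatrix M h).mulVec (U t) - U t + P t * P t + Q t * Q t)) t)
    (hU' : ∀ t, HasDerivAt U ((2 : ℝ) • V t) t) :
    ∀ t : ℝ, nsq h (P t) + nsq h (Q t) = nsq h (P 0) + nsq h (Q 0) := by
  have hd (t : ℝ) : HasDerivAt (fun s => nsq h (P s) + nsq h (Q s)) 0 t := by
    refine ((hasDerivAt_nsq h (hP' t)).fun_add (hasDerivAt_nsq h (hQ' t))).congr_deriv ?_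
    have hA := (cdMatrix_isSymm M h).dotProduct_mulVec_comm (P t) (Q t)
    have hU : P t ⬝ᵥ (U t * Q t) = Q t ⬝ᵥ (U t * P t) :=
      Finset.sum_congr rfl fun i _ => by simp only [Pi.mul_apply]; ring
    rw [dotProduct_neg, dotProduct_add, dotProduct_add, hA, hU]
    ring
  intro t
  exact is_const_of_deriv_eq_zero (fun s => (hd s).differentiableAt) (fun s => (hd s).deriv) t 0
end

section
/- Let M ≥ 2, h > 0, let A be the central-difference matrix, and let P, Q, U, V : ℝ → ℝ^{M−1} be functions such that for every t ∈ ℝ, Q has derivative A P(t) + U(t) ⊙ P(t) at t, P has derivative −(A Q(t) + U(t) ⊙ Q(t)) at t, V has derivative (1/2)·(A U(t) − U(t) + P(t) ⊙ P(t) + Q(t) ⊙ Q(t)) at t, and U has derivative 2 V(t) at t. Then the discrete energy is conserved: for every t ∈ ℝ, ℋ(P(t), Q(t), U(t), V(t)) = ℋ(P(0), Q(0), U(0), V(0)). -/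
open MeasureTheory ProbabilityTheory

theorem hasDerivAt_iph {m : ℕ} (h : ℝ) {f g : ℝ → Fin m → ℝ} {f' g' : Fin m → ℝ} {t : ℝ}
    (hf : HasDerivAt f f' t) (hg : HasDerivAt g g' t) :
    HasDerivAt (fun s => iph h (f s) (g s)) (iph h f' (g t) + iph h (f t) g') t := by
  rw [hasDerivAt_pi] at hf hg
  have key := (HasDerivAt.fun_sum (u := Finset.univ)
    fun i _ => (hf i).fun_mul (hg i)).const_mul h
  refine key.congr_deriv ?_
  simp only [iph, Finset.sum_add_distrib, mul_add]

theorem HasDerivAt.mulVec {m n : ℕ} (A : Matrix (Fin m) (Fin n) ℝ) {f : ℝ → Fin n → ℝ}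
    {f' : Fin n → ℝ} {t : ℝ} (hf : HasDerivAt f f' t) :
    HasDerivAt (fun s => A.mulVec (f s)) (A.mulVec f') t :=
  (LinearMap.toContinuousLinearMap A.mulVecLin).hasFDerivAt.comp_hasDerivAt t hf

theorem iph_mulVec_of_isSymm {m : ℕ} (h : ℝ) {A : Matrix (Fin m) (Fin m) ℝ} (hA : A.IsSymm)
    (f g : Fin m → ℝ) : iph h f (A.mulVec g) = iph h g (A.mulVec f) := by
  change h * (f ⬝ᵥ A.mulVec g) = h * (g ⬝ᵥ A.mulVec f)
  rw [Matrix.dotProduct_mulVec, ← Matrix.mulVec_transpose, hA.eq, dotProduct_comm]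

/-- The derivative of the energy along a differentiable curve. -/
theorem hasDerivAt_energy {m : ℕ} (h : ℝ) {A : Matrix (Fin m) (Fin m) ℝ} (hA : A.IsSymm)
    {P Q U V : ℝ → Fin m → ℝ} {P' Q' U' V' : Fin m → ℝ} {t : ℝ}
    (hP : HasDerivAt P P' t) (hQ : HasDerivAt Q Q' t)
    (hU : HasDerivAt U U' t) (hV : HasDerivAt V V' t) :
    HasDerivAt (fun s => energy h A (P s) (Q s) (U s) (V s))
      (2 * iph h U' (P t * P t + Q t * Q t - U t + A.mulVec (U t)) - 8 * iph h V' (V t)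
        + 4 * iph h P' (U t * P t + A.mulVec (P t))
        + 4 * iph h Q' (U t * Q t + A.mulVec (Q t))) t := by
  have key := ((((((hasDerivAt_iph h hU ((hP.mul hP).add (hQ.mul hQ))).const_mul 2).sub
    (hasDerivAt_iph h hU hU)).sub ((hasDerivAt_iph h hV hV).const_mul 4)).add
    (hasDerivAt_iph h hU (hU.mulVec A))).add
    ((hasDerivAt_iph h hP (hP.mulVec A)).const_mul 2)).add
    ((hasDerivAt_iph h hQ (hQ.mulVec A)).const_mul 2)
  refine key.congr_deriv ?_
  rw [iph_mulVec_of_isSymm h hA (U t), iph_mulVec_of_isSymm h hA (P t),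
    iph_mulVec_of_isSymm h hA (Q t)]
  simp only [iph, Finset.mul_sum, ← Finset.sum_add_distrib, ← Finset.sum_sub_distrib]
  refine Finset.sum_congr rfl fun i _ => ?_
  simp only [Pi.add_apply, Pi.mul_apply, Pi.sub_apply]
  ring

/-- The noise-free central-difference semi-discretization conserves the
discrete energy. -/
theorem stmt_12 {M : ℕ} (hM : 2 ≤ M) (h : ℝ) (hh : 0 < h)
    (P Q U V : ℝ → Fin (M - 1) → ℝ)
    (hQ' : ∀ t, HasDerivAt Q ((cdMatrix M h).mulVec (P t) + U t * P t) t)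
    (hP' : ∀ t, HasDerivAt P (-((cdMatrix M h).mulVec (Q t) + U t * Q t)) t)
    (hV' : ∀ t, HasDerivAt V
      ((2 : ℝ)⁻¹ • ((cdMatrix M h).mulVec (U t) - U t + P t * P t + Q t * Q t)) t)
    (hU' : ∀ t, HasDerivAt U ((2 : ℝ) • V t) t) :
    ∀ t : ℝ, energy h (cdMatrix M h) (P t) (Q t) (U t) (V t)
      = energy h (cdMatrix M h) (P 0) (Q 0) (U 0) (V 0) := by
  have hderiv : ∀ t, HasDerivAt
      (fun s => energy h (cdMatrix M h) (P s) (Q s) (U s) (V s)) 0 t := by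
    intro t
    refine (hasDerivAt_energy h (cdMatrix_isSymm M h) (hP' t) (hQ' t) (hU' t)
      (hV' t)).congr_deriv ?_
    simp only [iph, Finset.mul_sum, ← Finset.sum_add_distrib, ← Finset.sum_sub_distrib]
    refine Finset.sum_eq_zero fun i _ => ?_
    simp only [Pi.add_apply, Pi.mul_apply, Pi.sub_apply, Pi.neg_apply, Pi.smul_apply,
      smul_eq_mul]
    ring
  intro t
  exact is_const_of_deriv_eq_zero (fun s => (hderiv s).differentiableAt)
    (fun s => (hderiv s).deriv) t 0
end

section
/- Let V be a real vector space and ω : V × V → ℝ a bilinear map. Let s ≥ 1, Δt ∈ ℝ, and let a : Fin s → Fin s → ℝ and b : Fin s → ℝ satisfy the symplectic condition a m l · b m + a l m · b l = b m · b l for all m, l. Let ξ⁰, ζ⁰ ∈ V and φ, ψ : Fin s → V, and define the stage values ξ_m = ξ⁰ + Δt ∑_l a m l · φ_l and ζ_m = ζ⁰ + Δt ∑_l a m l · ψ_l, and the updates ξ¹ = ξ⁰ + Δt ∑_m b m · φ_m and ζ¹ = ζ⁰ + Δt ∑_m b m · ψ_m. Then ω(ξ¹, ζ¹) − ω(ξ⁰,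 ζ⁰) = Δt ∑_m b m · ( ω(φ_m, ζ_m) + ω(ξ_m, ψ_m) ). -/
open MeasureTheory ProbabilityTheory

/-- Under the symplectic condition, the term of a bilinear map quadratic in the weights splits into
the two terms that are linear in the stage coefficients. -/
theorem bilin_sum_smul_of_symplectic {R M ι : Type*} [CommRing R] [AddCommGroup M] [Module R M]
    [Fintype ι] (ω : M →ₗ[R] M →ₗ[R] R) {a : ι → ι → R} {b : ι → R}
    (hsymp : ∀ m l, a m l * b m + a l m * b l = b m * b l) (φ ψ : ι → M) :
    ω (∑ m, b m • φ m) (∑ m, b m • ψ m) =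
      ∑ m, b m * ω (φ m) (∑ l, a m l • ψ l) + ∑ m, b m * ω (∑ l, a m l • φ l) (ψ m) := by
  simp only [map_sum, map_smul, LinearMap.sum_apply, LinearMap.smul_apply, smul_eq_mul,
    Finset.mul_sum]
  rw [Finset.sum_comm (f := fun m l => b m * (a m l * ω (φ l) (ψ m))),
    ← Finset.sum_add_distrib]
  conv_lhs => rw [Finset.sum_comm]
  refine Finset.sum_congr rfl fun m _ => ?_
  rw [← Finset.sum_add_distrib]
  refine Finset.sum_congr rfl fun l _ => ?_
  linear_combination -(ω (φ m) (ψ l)) * hsymp m l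

/-- The key algebraic identity for `s`-stage Runge--Kutta methods satisfying
the symplectic condition `a m l * b m + a l m * b l = b m * b l`. -/
theorem stmt_13 {V : Type*} [AddCommGroup V] [Module ℝ V]
    (ω : V →ₗ[ℝ] V →ₗ[ℝ] ℝ) (s : ℕ) (hs : 1 ≤ s) (Δt : ℝ)
    (a : Fin s → Fin s → ℝ) (b : Fin s → ℝ)
    (hsymp : ∀ m l, a m l * b m + a l m * b l = b m * b l)
    (ξ0 ζ0 : V) (φ ψ : Fin s → V) (ξ ζ : Fin s → V)
    (hξ : ∀ m, ξ m = ξ0 + Δt • ∑ l, a m l • φ l)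
    (hζ : ∀ m, ζ m = ζ0 + Δt • ∑ l, a m l • ψ l)
    (ξ1 ζ1 : V)
    (hξ1 : ξ1 = ξ0 + Δt • ∑ m, b m • φ m)
    (hζ1 : ζ1 = ζ0 + Δt • ∑ m, b m • ψ m) :
    ω ξ1 ζ1 - ω ξ0 ζ0 = Δt * ∑ m, b m * (ω (φ m) (ζ m) + ω (ξ m) (ψ m)) := by
  have hquad := bilin_sum_smul_of_symplectic ω hsymp φ ψ
  have hleft : ω (∑ m, b m • φ m) ζ0 = ∑ m, b m * ω (φ m) ζ0 := by simp
  have hright : ω ξ0 (∑ m, b m • ψ m) = ∑ m, b m * ω ξ0 (ψ m) := by simp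
  have hstage : ∑ m, b m * (ω (φ m) (ζ m) + ω (ξ m) (ψ m)) =
      ω (∑ m, b m • φ m) ζ0 + ω ξ0 (∑ m, b m • ψ m) +
        Δt * ω (∑ m, b m • φ m) (∑ m, b m • ψ m) := by
    rw [hquad, hleft, hright, mul_add, Finset.mul_sum, Finset.mul_sum]
    simp only [← Finset.sum_add_distrib]
    refine Finset.sum_congr rfl fun m _ => ?_
    rw [hξ, hζ]
    simp only [map_add, map_smul, LinearMap.add_apply, LinearMap.smul_apply, smul_eq_mul]
    ring
  rw [hstage, hξ1, hζ1]
  simp only [map_add, map_smul, LinearMap.add_apply, LinearMap.smul_apply, smul_eq_mul]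
  ring
end
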